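/- Let A be a row-standard μ-tableau of type λ (μ ⊢ n, λ ⊨ n), let λ̃ be the type of the tableau obtained by deleting the first row of A, and set κ = (μ_1, λ̃_1, λ̃_2, …). Let B be the μ-tableau obtained from A by replacing every entry of the first row by 1 and adding 1 to every entry below the first row (a row-standard μ-tableau of type κ), and let C be the κ-tableau whose first row equals the first row of A and whose i-th row, for i ≥ 2, consists of λ̃_{i−1} copies of i−1 (a row-standard κ-tableau of type λ). Then φ_B φ_C = φ_A as homomorphisms M^μ → M^λ, where the composite applies φ_B first. -/

import Mathlib

open scoped Classical

noncomputable section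

namespace FayersSemistd

/-- The value at `q` of the Gaussian (quantum) binomial coefficient polynomial
`[a choose b]`, defined via the `q`-Pascal recurrence. -/
def qBinom {F : Type*} [Field F] (q : F) : ℕ → ℕ → F
  | _, 0 => 1
  | 0, _+1 => 0
  | a+1, b+1 => qBinom q a b + q ^ (b+1) * qBinom q a (b+1)

/-- `∏_i [A_i + B_i choose A_i]_q`, where `A_i`, `B_i` are multiplicities in the
multisets `A` and `B`. -/
def qBinomProd {F : Type*} [Field F] (q : F) (A B : Multiset ℕ) : F :=
  ∏ i ∈ (A + B).toFinset, qBinom q ((A + B).count i) (A.count i)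

/-- `∑_{i<j} A_j * B_i` : the number of pairs `(x,y)` with `x ∈ A`, `y ∈ B`, `y < x`,
counted with multiplicity. -/
def invPairs (A B : Multiset ℕ) : ℕ :=
  ((A.product B).filter (fun p => p.2 < p.1)).card

/-- The Coxeter length of a permutation of `{0,…,n-1}`: its number of inversions. -/
def permLength {n : ℕ} (w : Equiv.Perm (Fin n)) : ℕ :=
  (Finset.univ.filter (fun p : Fin n × Fin n => p.1 < p.2 ∧ w p.2 < w p.1)).card

/-- `λ_0 + ⋯ + λ_{r-1}`. -/
def cumSum (lam : ℕ → ℕ) (r : ℕ) : ℕ := ∑ i ∈ Finset.range r, lam i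

/-- The (0-indexed) row of the diagram of `λ` containing the (0-indexed) position `p`,
when positions are listed row by row. -/
def rowOf (lam : ℕ → ℕ) (p : ℕ) : ℕ := sInf {r | p < cumSum lam (r+1)}

/-- `λ` is a composition of `n`: finitely many nonzero parts, summing to `n`. -/
def IsComposition (n : ℕ) (lam : ℕ → ℕ) : Prop :=
  ∃ N, (∀ r, N ≤ r → lam r = 0) ∧ cumSum lam N = n

/-- `μ` is a partition of `n`. -/
def IsPartition (n : ℕ) (mu : ℕ → ℕ) : Prop := IsComposition n mu ∧ Antitone mu

/-- The conjugate partition (0-indexed): `conjP μ i = #{r | μ r > i}`. -/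
def conjP (mu : ℕ → ℕ) (i : ℕ) : ℕ := sInf {r | mu r ≤ i}

/-- The standard Young subgroup `W_λ` of `S_n` (as a set): the permutations preserving
each consecutive block of sizes `λ_0, λ_1, …`. -/
def youngW {n : ℕ} (lam : ℕ → ℕ) : Set (Equiv.Perm (Fin n)) :=
  {w | ∀ p : Fin n, rowOf lam ((w p : Fin n) : ℕ) = rowOf lam (p : ℕ)}

/-- The adjacent transposition `(i, i+1)` (0-indexed) in `S_n`. -/
def adjT {n : ℕ} (i : ℕ) (h : i + 1 < n) : Equiv.Perm (Fin n) :=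
  Equiv.swap ⟨i, Nat.lt_of_succ_lt h⟩ ⟨i+1, h⟩

/-- `T : S_n → H` is the standard basis of an Iwahori–Hecke algebra of `S_n` over `F`
with parameter `q`.  Permutations act on the right, so the product `w·s` of the paper
is `s * w` in Mathlib's convention; the multiplication rule
`T_w T_s = T_{ws}` (length increasing) resp. `T_w T_s = q T_{ws} + (q-1) T_w`
(length decreasing) determines the algebra structure on the basis. -/
structure IsHeckeBasis {F : Type*} [Field F] {H : Type*} [Ring H] [Algebra F H] {n : ℕ}
    (q : F) (T : Equiv.Perm (Fin n) → H) : Prop where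
  li : LinearIndependent F T
  total : Submodule.span F (Set.range T) = ⊤
  one : T 1 = 1
  mul_adj_asc : ∀ (w : Equiv.Perm (Fin n)) (i : ℕ) (h : i + 1 < n),
    permLength w < permLength (adjT i h * w) →
    T w * T (adjT i h) = T (adjT i h * w)
  mul_adj_desc : ∀ (w : Equiv.Perm (Fin n)) (i : ℕ) (h : i + 1 < n),
    permLength (adjT i h * w) < permLength w →
    T w * T (adjT i h) = q • T (adjT i h * w) + (q - 1) • T w

variable {F : Type*} [Field F] {H : Type*} [Ring H] [Algebra F H] {n : ℕ}

/-- `x_λ = ∑_{w ∈ W_λ} T_w`. -/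
def xElt (T : Equiv.Perm (Fin n) → H) (lam : ℕ → ℕ) : H :=
  ∑ w ∈ Finset.univ.filter (· ∈ youngW lam), T w

/-- `y_λ = ∑_{w ∈ W_λ} (-q)^{-l(w)} T_w`. -/
def yElt (q : F) (T : Equiv.Perm (Fin n) → H) (lam : ℕ → ℕ) : H :=
  ∑ w ∈ Finset.univ.filter (· ∈ youngW lam), ((-q)⁻¹) ^ permLength w • T w

/-- The double coset `W_λ d W_μ` (paper convention: maps act on the right, so the
paper product `u·d·v` is `v * d * u` in Mathlib's convention). -/
def doubleCoset {n : ℕ} (lam mu : ℕ → ℕ) (d : Equiv.Perm (Fin n)) :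
    Set (Equiv.Perm (Fin n)) :=
  {w | ∃ u ∈ youngW (n := n) lam, ∃ v ∈ youngW (n := n) mu, w = v * d * u}

/-- `∑_{w ∈ W_λ 1_A W_μ} T_w`, the image `x_μ φ_A` of `x_μ` under the tableau
homomorphism `φ_A : M^μ → M^λ`, where `d = 1_A`. -/
def XPhi (T : Equiv.Perm (Fin n) → H) (lam mu : ℕ → ℕ) (d : Equiv.Perm (Fin n)) : H :=
  ∑ w ∈ Finset.univ.filter (· ∈ doubleCoset lam mu d), T w

/-- A row-standard tableau is recorded by the multisets of entries of its rows; it has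
shape `μ` when row `r` has `μ_r` entries. -/
def RowsOfShape (mu : ℕ → ℕ) (A : ℕ → Multiset ℕ) : Prop := ∀ r, (A r).card = mu r

/-- The tableau with rows `A 0, A 1, …` has type `λ` when the entry `v` occurs `λ_v`
times in total (entries and types are 0-indexed). -/
def HasType (A : ℕ → Multiset ℕ) (lam : ℕ → ℕ) : Prop :=
  ∀ v, (∑ᶠ r, (A r).count v) = lam v

/-- The entry in row `r`, column `c` (0-indexed) of the row-standard tableau with row
multisets `A`. -/
def entryAt (A : ℕ → Multiset ℕ) (r c : ℕ) : ℕ := ((A r).sort (· ≤ ·)).getD c 0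

/-- `d = 1_A` for the row-standard `μ`-tableau `A` of type `λ`: the tableau `t^λ d`
(whose entry at position `p` is `d p`) is row-standard (first clause), and the entry
`d p` lies in row `r` of `t^λ d` exactly when the position occupied by `d p` in `t^μ`
is occupied by `r` in `A` (second clause). -/
def Is1A {n : ℕ} (mu lam : ℕ → ℕ) (A : ℕ → Multiset ℕ) (d : Equiv.Perm (Fin n)) : Prop :=
  (∀ p p' : Fin n, rowOf lam (p : ℕ) = rowOf lam (p' : ℕ) → p < p' → d p < d p') ∧
  (∀ p : Fin n,
    entryAt A (rowOf mu ((d p : Fin n) : ℕ))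
      (((d p : Fin n) : ℕ) - cumSum mu (rowOf mu ((d p : Fin n) : ℕ)))
      = rowOf lam (p : ℕ))

/-- A row-standard tableau is semistandard if its columns are strictly increasing. -/
def Semistandard (mu : ℕ → ℕ) (A : ℕ → Multiset ℕ) : Prop :=
  ∀ r c, c < mu (r+1) → entryAt A r c < entryAt A (r+1) c

/-- The (0-indexed) column of the position `p` in the diagram of `μ`. -/
def colIdx (mu : ℕ → ℕ) (p : ℕ) : ℕ := p - cumSum mu (rowOf mu p)

/-- `w = w_μ`, i.e. `t^μ w = t_μ`: the image of position `p` is the number of positions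
coming strictly before `p` in the column-reading order of the diagram of `μ`. -/
def IsWmu {n : ℕ} (mu : ℕ → ℕ) (w : Equiv.Perm (Fin n)) : Prop :=
  ∀ p : Fin n, ((w p : Fin n) : ℕ) = (Finset.univ.filter (fun p' : Fin n =>
    colIdx mu (p' : ℕ) < colIdx mu (p : ℕ) ∨
      (colIdx mu (p' : ℕ) = colIdx mu (p : ℕ) ∧ rowOf mu (p' : ℕ) < rowOf mu (p : ℕ)))).card

def comp1 (a : ℕ) : ℕ → ℕ := fun r => if r = 0 then a else 0
def comp2 (a b : ℕ) : ℕ → ℕ := fun r => if r = 0 then a else if r = 1 then b else 0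
def comp3 (a b c : ℕ) : ℕ → ℕ :=
  fun r => if r = 0 then a else if r = 1 then b else if r = 2 then c else 0
def comp4 (a b c d : ℕ) : ℕ → ℕ :=
  fun r => if r = 0 then a else if r = 1 then b else if r = 2 then c else if r = 3 then d else 0
def rows1 (a : Multiset ℕ) : ℕ → Multiset ℕ := fun r => if r = 0 then a else 0
def rows2 (a b : Multiset ℕ) : ℕ → Multiset ℕ :=
  fun r => if r = 0 then a else if r = 1 then b else 0
def rows3 (a b c : Multiset ℕ) : ℕ → Multiset ℕ :=
  fun r => if r = 0 then a else if r = 1 then b else if r = 2 then c else 0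
def rows4 (a b c d : Multiset ℕ) : ℕ → Multiset ℕ :=
  fun r => if r = 0 then a else if r = 1 then b else if r = 2 then c else if r = 3 then d else 0

end FayersSemistd
namespace FayersSemistd

/-! ### Lengths and products of basis elements -/

lemma permLength_lt_adjT_mul {n : ℕ} (x : Equiv.Perm (Fin n)) (i : ℕ) (h : i + 1 < n)
    (hx : x⁻¹ ⟨i, Nat.lt_of_succ_lt h⟩ < x⁻¹ ⟨i + 1, h⟩) :
    permLength x < permLength (adjT i h * x) := by
  unfold permLength
  apply Finset.card_lt_card
  rw [Finset.ssubset_iff_of_subset]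
  · refine ⟨(x⁻¹ ⟨i, Nat.lt_of_succ_lt h⟩, x⁻¹ ⟨i + 1, h⟩), ?_, ?_⟩
    · simp only [Finset.mem_filter, Finset.mem_univ, true_and]
      refine ⟨hx, ?_⟩
      simp [adjT]
    · simp
  · rintro ⟨p, p'⟩ hp
    simp only [Finset.mem_filter, Finset.mem_univ, true_and] at hp ⊢
    refine ⟨hp.1, ?_⟩
    have key : ¬ (x p' = ⟨i, Nat.lt_of_succ_lt h⟩ ∧ x p = ⟨i + 1, h⟩) := by
      rintro ⟨h1, h2⟩
      rw [← h1, ← h2] at hx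
      simp only [Equiv.Perm.inv_def, Equiv.symm_apply_apply] at hx
      exact absurd hp.1 hx.not_gt
    have hlt := hp.2
    simp only [Equiv.Perm.coe_mul, Function.comp_apply, adjT, Equiv.swap_apply_def]
    generalize x p = a at *
    generalize x p' = b at *
    simp only [Fin.lt_def, Fin.ext_iff] at *
    split_ifs <;> simp_all <;> omega

lemma exists_descent {n : ℕ} {b : Equiv.Perm (Fin n)} (hb : b ≠ 1) :
    ∃ (i : ℕ) (h : i + 1 < n), b⁻¹ ⟨i + 1, h⟩ < b⁻¹ ⟨i, Nat.lt_of_succ_lt h⟩ := by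
  by_contra! hcon
  apply hb
  rw [← inv_eq_one, ← Equiv.Perm.monotone_iff]
  cases n with
  | zero => intro i; exact i.elim0
  | succ m =>
    rw [Fin.monotone_iff_le_succ]
    intro i
    exact hcon i (by omega)

/-- `T_a T_b = T_{ab}` when no inversion of `a` is undone by `b`. -/
lemma IsHeckeBasis.mul_of_inversions {F : Type*} [Field F] {H : Type*} [Ring H] [Algebra F H]
    {n : ℕ} {q : F} {T : Equiv.Perm (Fin n) → H}
    (hT : IsHeckeBasis q T) (a b : Equiv.Perm (Fin n))
    (hab : ∀ p p', p < p' → a p' < a p → b (a p') < b (a p)) :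
    T a * T b = T (b * a) := by
  induction hk : permLength b using Nat.strong_induction_on generalizing b with
  | _ k ih =>
  subst hk
  by_cases hb : b = 1
  · simp [hb, hT.one]
  obtain ⟨i, h, hi⟩ := exists_descent hb
  set s := adjT i h with hs
  have hss : s * s = 1 := by simp [hs, adjT]
  have hsi : s⁻¹ = s := inv_eq_of_mul_eq_one_left hss
  obtain ⟨b', rfl⟩ : ∃ b', b = s * b' := ⟨s * b, by rw [← mul_assoc, hss, one_mul]⟩
  have hs1 : s ⟨i, Nat.lt_of_succ_lt h⟩ = ⟨i + 1, h⟩ := by simp [hs, adjT]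
  have hs2 : s ⟨i + 1, h⟩ = ⟨i, Nat.lt_of_succ_lt h⟩ := by simp [hs, adjT]
  rw [mul_inv_rev, hsi, Equiv.Perm.mul_apply, Equiv.Perm.mul_apply, hs1, hs2] at hi
  have hlen := permLength_lt_adjT_mul b' i h hi
  have hlen' : permLength (b' * a) < permLength (s * (b' * a)) := by
    apply permLength_lt_adjT_mul
    rw [mul_inv_rev, Equiv.Perm.mul_apply, Equiv.Perm.mul_apply]
    by_contra hcon
    have hne : a⁻¹ (b'⁻¹ ⟨i, Nat.lt_of_succ_lt h⟩) ≠ a⁻¹ (b'⁻¹ ⟨i + 1, h⟩) := by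
      simp
    have := hab _ _ (lt_of_le_of_ne (not_lt.1 hcon) hne.symm) (by simpa using hi)
    simp [hs1, hs2, Fin.lt_def] at this
  rw [← hT.mul_adj_asc b' i h hlen, ← mul_assoc, ih _ hlen b' ?_ rfl,
    hT.mul_adj_asc _ i h hlen', mul_assoc]
  intro p p' hpp ha
  have h1 := hab p p' hpp ha
  by_contra hcon
  rw [Equiv.Perm.mul_apply, Equiv.Perm.mul_apply] at h1
  have hne : b' (a p) ≠ b' (a p') := by
    simpa using hpp.ne
  have hlt := lt_of_le_of_ne (not_lt.1 hcon) hne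
  have key : ¬ (b' (a p) = ⟨i, Nat.lt_of_succ_lt h⟩ ∧ b' (a p') = ⟨i + 1, h⟩) := by
    rintro ⟨h2, h3⟩
    rw [← h2, ← h3] at hi
    simp only [Equiv.Perm.inv_def, Equiv.symm_apply_apply] at hi
    exact absurd ha hi.not_gt
  clear hi hcon hs1 hs2 hlen' hlen hsi hss ih hab hne
  rw [hs] at h1
  simp only [adjT, Equiv.swap_apply_def] at h1
  generalize b' (a p) = u at *
  generalize b' (a p') = v at *
  simp only [Fin.lt_def, Fin.ext_iff] at *
  split_ifs at h1 <;> simp_all <;> omega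

/-! ### Permutations increasing on the rows of a composition -/

/-- `t^λ e` is row-standard. -/
def RowIncreasing {n : ℕ} (lam : ℕ → ℕ) (e : Equiv.Perm (Fin n)) : Prop :=
  ∀ p p' : Fin n, rowOf lam (p : ℕ) = rowOf lam (p' : ℕ) → p < p' → e p < e p'

lemma RowIncreasing.eq_sort {n : ℕ} {lam : ℕ → ℕ} (hm : Monotone fun p : Fin n => rowOf lam p)
    {e : Equiv.Perm (Fin n)} (he : RowIncreasing lam e) {f : Fin n → ℕ}
    (hf : ∀ p, f (e p) = rowOf lam p) : e = Tuple.sort f := by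
  rw [Tuple.eq_sort_iff]
  refine ⟨fun p p' hp => ?_, fun p p' hlt hp => he p p' ?_ hlt⟩
  · simpa [hf] using hm hp
  · rwa [hf, hf] at hp

lemma RowIncreasing.ext {n : ℕ} {lam : ℕ → ℕ} (hm : Monotone fun p : Fin n => rowOf lam p)
    {e e' : Equiv.Perm (Fin n)} (he : RowIncreasing lam e) (he' : RowIncreasing lam e')
    (h : ∀ z, rowOf lam (e⁻¹ z : Fin n) = rowOf lam (e'⁻¹ z : Fin n)) : e = e' := by
  rw [he.eq_sort hm (f := fun z => rowOf lam (e⁻¹ z : Fin n)) (by simp)]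
  exact (he'.eq_sort hm fun p => by rw [h]; simp).symm

lemma exists_rowIncreasing_mul {n : ℕ} {lam : ℕ → ℕ} (hm : Monotone fun p : Fin n => rowOf lam p)
    (x : Equiv.Perm (Fin n)) :
    ∃ e, RowIncreasing lam e ∧ ∃ w ∈ youngW (n := n) lam, x = e * w := by
  set f : Fin n → ℕ := fun z => rowOf lam (x⁻¹ z : Fin n) with hf
  have hfx : f ∘ x = fun p : Fin n => rowOf lam p := by
    funext p; simp [hf]
  have hfs : f ∘ Tuple.sort f = fun p : Fin n => rowOf lam p := by
    rw [← hfx]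
    exact Tuple.unique_monotone (Tuple.monotone_sort f) (hfx ▸ hm)
  have hfs' : ∀ p, f (Tuple.sort f p) = rowOf lam p := fun p => congrFun hfs p
  refine ⟨Tuple.sort f, fun p p' hr hp => ?_, (Tuple.sort f)⁻¹ * x, fun p => ?_, by simp⟩
  · exact ((Tuple.eq_sort_iff (f := f)).1 rfl).2 p p' hp (by rw [hfs', hfs', hr])
  · rw [← hfs', ← congrFun hfx p]
    simp

lemma mul_mem_youngW {n : ℕ} {lam : ℕ → ℕ} {v w : Equiv.Perm (Fin n)} (hv : v ∈ youngW (n := n) lam)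
    (hw : w ∈ youngW (n := n) lam) : v * w ∈ youngW (n := n) lam :=
  fun p => (hv (w p)).trans (hw p)

lemma inv_mem_youngW {n : ℕ} {lam : ℕ → ℕ} {w : Equiv.Perm (Fin n)} (hw : w ∈ youngW (n := n) lam) :
    w⁻¹ ∈ youngW (n := n) lam := by
  intro p
  simpa using (hw (w⁻¹ p)).symm

/-- A permutation of an initial segment extended by the identity. -/
lemma exists_restrict {n : ℕ} {m : ℕ} {k : Equiv.Perm (Fin n)} (hk : ∀ z, (k z : ℕ) < m ↔ (z : ℕ) < m) :
    ∃ k' : Equiv.Perm (Fin n), (∀ z : Fin n, (z : ℕ) < m → k' z = k z) ∧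
      ∀ z : Fin n, ¬ (z : ℕ) < m → k' z = z :=
  ⟨Equiv.Perm.ofSubtype (k.subtypePerm (p := fun z : Fin n => (z : ℕ) < m) hk),
    fun _ hz => Equiv.Perm.ofSubtype_subtypePerm_of_mem hk hz,
    fun _ hz => Equiv.Perm.ofSubtype_subtypePerm_of_not_mem hk hz⟩

lemma eq_self_of_increasing {n : ℕ} {m : ℕ} {e : Equiv.Perm (Fin n)}
    (he : ∀ z, (e z : ℕ) < m ↔ (z : ℕ) < m)
    (hinc : ∀ z z' : Fin n, (z : ℕ) < m → (z' : ℕ) < m → z < z' → e z < e z')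
    {z : Fin n} (hz : (z : ℕ) < m) : e z = z := by
  obtain ⟨k, hk, hk'⟩ := exists_restrict he
  have : k = 1 := by
    rw [← Equiv.Perm.monotone_iff]
    refine StrictMono.monotone fun p p' hp => ?_
    by_cases h' : (p' : ℕ) < m
    · have h : (p : ℕ) < m := lt_trans hp h'
      rw [hk _ h, hk _ h']
      exact hinc p p' h h' hp
    · rw [hk' _ h']
      by_cases h : (p : ℕ) < m
      · have := (he p).2 h
        rw [hk _ h, Fin.lt_def]
        omega
      · rwa [hk' _ h]
  rw [← hk z hz, this]
  rfl

/-! ### Factorisations of double coset sums -/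

lemma IsHeckeBasis.sum_mul_sum {F : Type*} [Field F] {H : Type*} [Ring H] [Algebra F H]
    {n : ℕ} {q : F} {T : Equiv.Perm (Fin n) → H} (hT : IsHeckeBasis q T)
    (U D X : Finset (Equiv.Perm (Fin n)))
    (hinv : ∀ u ∈ U, ∀ e ∈ D, ∀ p p', p < p' → u p' < u p → e (u p') < e (u p))
    (hmem : ∀ u ∈ U, ∀ e ∈ D, e * u ∈ X)
    (hinj : ∀ u ∈ U, ∀ e ∈ D, ∀ u' ∈ U, ∀ e' ∈ D, e * u = e' * u' → e = e')
    (hsurj : ∀ x ∈ X, ∃ u ∈ U, ∃ e ∈ D, e * u = x) :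
    (∑ u ∈ U, T u) * ∑ e ∈ D, T e = ∑ x ∈ X, T x := by
  rw [Finset.sum_mul_sum, ← Finset.sum_product']
  refine Finset.sum_bij (fun a _ => a.2 * a.1) ?_ ?_ ?_ ?_
  · rintro ⟨u, e⟩ h
    rw [Finset.mem_product] at h
    exact hmem u h.1 e h.2
  · rintro ⟨u, e⟩ h ⟨u', e'⟩ h' heq
    rw [Finset.mem_product] at h h'
    obtain rfl : e = e' := hinj u h.1 e h.2 u' h'.1 e' h'.2 heq
    rw [show u = u' from mul_left_cancel heq]
  · intro x hx
    obtain ⟨u, hu, e, he, rfl⟩ := hsurj x hx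
    exact ⟨(u, e), Finset.mem_product.2 ⟨hu, he⟩, rfl⟩
  · rintro ⟨u, e⟩ h
    rw [Finset.mem_product] at h
    exact hT.mul_of_inversions u e (hinv u h.1 e h.2)

/-- The minimal length representatives of the cosets of `W_λ` in `W_λ d W_μ`. -/
def cosetReps {n : ℕ} (lam mu : ℕ → ℕ) (d : Equiv.Perm (Fin n)) :
    Finset (Equiv.Perm (Fin n)) :=
  Finset.univ.filter fun e => e ∈ doubleCoset lam mu d ∧ RowIncreasing lam e

lemma IsHeckeBasis.XPhi_eq {F : Type*} [Field F] {H : Type*} [Ring H] [Algebra F H]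
    {n : ℕ} {q : F} {T : Equiv.Perm (Fin n) → H} (hT : IsHeckeBasis q T) {lam mu : ℕ → ℕ}
    (hm : Monotone fun p : Fin n => rowOf lam p) (d : Equiv.Perm (Fin n)) :
    XPhi T lam mu d = xElt T lam * ∑ e ∈ cosetReps lam mu d, T e := by
  refine (hT.sum_mul_sum _ _ _ ?_ ?_ ?_ ?_).symm <;>
    simp only [cosetReps, Finset.mem_filter, Finset.mem_univ, true_and]
  · rintro w hw e ⟨-, he⟩ p p' hp hlt
    refine he _ _ (le_antisymm ?_ ?_) hlt
    · exact hm hlt.le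
    · rw [hw, hw]
      exact hm hp.le
  · rintro w hw e ⟨⟨u, hu, v, hv, rfl⟩, -⟩
    exact ⟨u * w, mul_mem_youngW hu hw, v, hv, by simp only [mul_assoc]⟩
  · rintro w hw e ⟨-, he⟩ w' hw' e' ⟨-, he'⟩ heq
    refine he.ext hm he' fun z => ?_
    have h1 : e⁻¹ * (e * w) = w := by simp
    have h2 : e'⁻¹ * (e * w) = w' := by simp [heq]
    obtain ⟨p, rfl⟩ := (e * w).surjective z
    rw [← Equiv.Perm.mul_apply, ← Equiv.Perm.mul_apply, h1, h2, hw, hw']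
  · rintro x ⟨u, hu, v, hv, rfl⟩
    obtain ⟨e, he, w, hw, hx⟩ := exists_rowIncreasing_mul hm (v * d * u)
    refine ⟨w, hw, e, ⟨⟨u * w⁻¹, mul_mem_youngW hu (inv_mem_youngW hw), v, hv, ?_⟩, he⟩, hx.symm⟩
    rw [← mul_assoc, hx, mul_inv_cancel_right]

/-- Suppose that `b` fixes the first row of `κ`, and that each lower row `s + 1` of `κ` is filled
by `c` from row `s` of `λ` only. Then the double coset sums of `b` and `c` multiply to that of
the product of `b` and `c`. -/
lemma IsHeckeBasis.XPhi_mul_sum_cosetReps {F : Type*} [Field F] {H : Type*} [Ring H] [Algebra F H]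
    {n m : ℕ} {q : F} {T : Equiv.Perm (Fin n) → H} (hT : IsHeckeBasis q T) {lam mu kap : ℕ → ℕ}
    (hlam : Monotone fun p : Fin n => rowOf lam p)
    (hkap : Monotone fun p : Fin n => rowOf kap p)
    (hkap0 : ∀ p : Fin n, rowOf kap p = 0 ↔ (p : ℕ) < m)
    (hmu0 : ∀ p : Fin n, rowOf mu p = 0 ↔ (p : ℕ) < m)
    {b c : Equiv.Perm (Fin n)}
    (hb : ∀ p, (b p : ℕ) < m ↔ (p : ℕ) < m) (hbinc : RowIncreasing kap b)
    (hc : ∀ p, ¬ (c p : ℕ) < m → rowOf lam p + 1 = rowOf kap (c p : Fin n)) :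
    XPhi T lam kap c * ∑ e ∈ cosetReps kap mu b, T e = XPhi T lam mu (b * c) := by
  have hkapW : ∀ w ∈ youngW (n := n) kap, ∀ p, (w p : ℕ) < m ↔ (p : ℕ) < m := fun w hw p => by
    rw [← hkap0, hw, hkap0]
  have hmuW : ∀ w ∈ youngW (n := n) mu, ∀ p, (w p : ℕ) < m ↔ (p : ℕ) < m := fun w hw p => by
    rw [← hmu0, hw, hmu0]
  have hinc0 : ∀ e : Equiv.Perm (Fin n), RowIncreasing kap e → (∀ p, (e p : ℕ) < m ↔ (p : ℕ) < m) →
      ∀ p : Fin n, (p : ℕ) < m → e p = p := fun e he hem p hp =>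
    eq_self_of_increasing hem (fun z z' hz hz' =>
      he z z' (((hkap0 z).2 hz).trans ((hkap0 z').2 hz').symm)) hp
  have hem : ∀ e ∈ doubleCoset kap mu b, ∀ p, (e p : ℕ) < m ↔ (p : ℕ) < m := by
    rintro e ⟨u, hu, v, hv, rfl⟩ p
    rw [Equiv.Perm.mul_apply, Equiv.Perm.mul_apply, hmuW v hv, hb, hkapW u hu]
  have huc : ∀ u ∈ doubleCoset lam kap c, ∀ p, ¬ (u p : ℕ) < m →
      rowOf lam p + 1 = rowOf kap (u p : Fin n) := by
    rintro u ⟨w, hw, v, hv, rfl⟩ p hp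
    rw [Equiv.Perm.mul_apply, Equiv.Perm.mul_apply, hkapW v hv] at hp
    rw [Equiv.Perm.mul_apply, Equiv.Perm.mul_apply, hv, ← hc _ hp, hw]
  refine hT.sum_mul_sum _ _ _ ?_ ?_ ?_ ?_ <;>
    simp only [cosetReps, Finset.mem_filter, Finset.mem_univ, true_and]
  · rintro u hu e ⟨he, hinc⟩ p p' hp hlt
    have h0 := hinc0 e hinc (hem e he)
    by_cases h' : (u p' : ℕ) < m
    · rw [h0 _ h']
      by_cases h : (u p : ℕ) < m
      · rwa [h0 _ h]
      · have := mt (hem e he (u p)).1 h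
        rw [Fin.lt_def]
        omega
    · have h : ¬ (u p : ℕ) < m := fun h => h' (lt_trans hlt h)
      refine hinc _ _ (le_antisymm (hkap hlt.le) ?_) hlt
      rw [← huc u hu p h, ← huc u hu p' h']
      exact Nat.succ_le_succ (hlam hp.le)
  · rintro u ⟨w, hw, k', hk', rfl⟩ e ⟨⟨k, hk, v, hv, rfl⟩, -⟩
    have hkk := mul_mem_youngW hk hk'
    obtain ⟨k₁, h₁, h₁'⟩ := exists_restrict (hkapW _ hkk)
    obtain ⟨k₂, hk₂⟩ : ∃ k₂, k * k' = k₁ * k₂ := ⟨k₁⁻¹ * (k * k'), by simp⟩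
    have hk₁m : ∀ p, (k₁ p : ℕ) < m ↔ (p : ℕ) < m := fun p => by
      by_cases hp : (p : ℕ) < m
      · rw [h₁ p hp, hkapW _ hkk]
      · rw [h₁' p hp]
    have hk₂1 : ∀ p : Fin n, (p : ℕ) < m → k₂ p = p := fun p hp => by
      apply k₁.injective
      rw [← Equiv.Perm.mul_apply, ← hk₂, h₁ p hp]
    have hk₂2 : ∀ p : Fin n, ¬ (p : ℕ) < m → k₂ p = (k * k') p := fun p hp => by
      rw [hk₂, Equiv.Perm.mul_apply, h₁']
      rwa [← hk₁m, ← Equiv.Perm.mul_apply, ← hk₂, hkapW _ hkk]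
    have hcomm : b * k₁ = k₁ * b := by
      ext1 p
      rw [Equiv.Perm.mul_apply, Equiv.Perm.mul_apply]
      have hb0 := hinc0 b hbinc hb
      by_cases hp : (p : ℕ) < m
      · rw [hb0 p hp, hb0 _ ((hk₁m p).2 hp)]
      · rw [h₁' p hp, h₁' _ (mt (hb p).1 hp)]
    have hk₁mu : k₁ ∈ youngW (n := n) mu := fun p => by
      by_cases hp : (p : ℕ) < m
      · rw [(hmu0 p).2 hp, hmu0, hk₁m]
        exact hp
      · rw [h₁' p hp]
    have hconj : c⁻¹ * k₂ * c ∈ youngW (n := n) lam := fun p => by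
      rw [Equiv.Perm.mul_apply, Equiv.Perm.mul_apply]
      by_cases hp : (c p : ℕ) < m
      · rw [hk₂1 _ hp, Equiv.Perm.inv_def, Equiv.symm_apply_apply]
      · rw [hk₂2 _ hp]
        have h1 := hc (c⁻¹ ((k * k') (c p)))
        rw [← Equiv.Perm.mul_apply c, mul_inv_cancel, Equiv.Perm.one_apply, hkapW _ hkk, hkk] at h1
        have h2 := h1 hp
        rw [← hc p hp] at h2
        exact Nat.succ.inj h2
    refine ⟨c⁻¹ * k₂ * c * w, mul_mem_youngW hconj hw, v * k₁, mul_mem_youngW hv hk₁mu, ?_⟩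
    calc v * b * k * (k' * c * w) = v * b * (k * k') * c * w := by simp only [mul_assoc]
      _ = v * (b * k₁) * k₂ * c * w := by rw [hk₂]; simp only [mul_assoc]
      _ = _ := by rw [hcomm]; simp only [mul_assoc, mul_inv_cancel_left]
  · have key : ∀ u ∈ doubleCoset lam kap c, ∀ e ∈ doubleCoset kap mu b, ∀ p,
        rowOf kap (u p : Fin n) = if ((e * u) p : ℕ) < m then 0 else rowOf lam p + 1 := by
      intro u hu e he p
      have hiff : ((e * u) p : ℕ) < m ↔ (u p : ℕ) < m := hem e he _
      split_ifs with h
      · exact (hkap0 _).2 (hiff.1 h)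
      · exact (huc u hu p (mt hiff.2 h)).symm
    rintro u hu e ⟨he, hinc⟩ u' hu' e' ⟨he', hinc'⟩ heq
    refine hinc.ext hkap hinc' fun z => ?_
    have h1 : e⁻¹ * (e * u) = u := by simp
    have h2 : e'⁻¹ * (e * u) = u' := by simp [heq]
    obtain ⟨p, rfl⟩ := (e * u).surjective z
    rw [← Equiv.Perm.mul_apply, ← Equiv.Perm.mul_apply, h1, h2, key u hu e he,
      key u' hu' e' he', heq]
  · rintro x ⟨w, hw, v, hv, rfl⟩
    obtain ⟨e, he, k, hk, hx⟩ := exists_rowIncreasing_mul hkap (v * b)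
    refine ⟨k * c * w, ⟨w, hw, k, hk, rfl⟩, e,
      ⟨⟨k⁻¹, inv_mem_youngW hk, v, hv, by rw [hx, mul_inv_cancel_right]⟩, he⟩, ?_⟩
    rw [← mul_assoc v, hx]
    simp only [mul_assoc]

/-! ### Rows of compositions and entries of tableaux -/

lemma rowOf_spec {lam : ℕ → ℕ} {p : ℕ} (h : ∃ r, p < cumSum lam r) :
    cumSum lam (rowOf lam p) ≤ p ∧ p < cumSum lam (rowOf lam p) + lam (rowOf lam p) := by
  have hne : {r | p < cumSum lam (r + 1)}.Nonempty := by
    obtain ⟨r, hr⟩ := h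
    refine ⟨r, hr.trans_le ?_⟩
    simp [cumSum, Finset.sum_range_succ]
  have hmem : rowOf lam p ∈ {r | p < cumSum lam (r + 1)} := Nat.sInf_mem hne
  refine ⟨?_, by simpa [cumSum, Finset.sum_range_succ] using hmem⟩
  rcases hr : rowOf lam p with _ | r
  · simp [cumSum]
  · by_contra! hcon
    have := Nat.sInf_le (s := {r | p < cumSum lam (r + 1)}) hcon
    change rowOf lam p ≤ r at this
    omega

lemma rowOf_mono {lam : ℕ → ℕ} {p p' : ℕ} (hp : p ≤ p') (h : ∃ r, p' < cumSum lam r) :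
    rowOf lam p ≤ rowOf lam p' := by
  apply Nat.sInf_le
  have := (rowOf_spec h).2
  simp only [cumSum, Set.mem_ofPred_eq, Finset.sum_range_succ] at *
  omega

lemma rowOf_eq_zero {lam : ℕ → ℕ} {p : ℕ} (h : ∃ r, p < cumSum lam r) :
    rowOf lam p = 0 ↔ p < lam 0 := by
  constructor
  · intro h0
    simpa [h0, cumSum] using (rowOf_spec h).2
  · intro h0
    apply Nat.eq_zero_of_le_zero
    apply Nat.sInf_le
    simpa [cumSum] using h0

lemma colIdx_lt {lam : ℕ → ℕ} {p : ℕ} (h : ∃ r, p < cumSum lam r) :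
    colIdx lam p < lam (rowOf lam p) := by
  have := rowOf_spec h
  unfold colIdx
  omega

lemma entryAt_mem {A : ℕ → Multiset ℕ} {r c : ℕ} (h : c < (A r).card) : entryAt A r c ∈ A r := by
  have hl : c < ((A r).sort (· ≤ ·)).length := by simpa using h
  rw [entryAt, List.getD_eq_getElem _ _ hl, ← Multiset.mem_sort (· ≤ ·)]
  exact List.getElem_mem hl

lemma entryAt_map_succ {A B : ℕ → Multiset ℕ} {r c : ℕ} (hB : B r = (A r).map (· + 1))
    (h : c < (A r).card) : entryAt B r c = entryAt A r c + 1 := by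
  have hl : c < ((A r).sort (· ≤ ·)).length := by simpa using h
  rw [entryAt, entryAt, hB,
    ← Multiset.map_sort (r := (· ≤ ·)) (r' := (· ≤ ·)) (· + 1) (A r) (by simp),
    List.getD_eq_getElem _ _ hl, List.getD_eq_getElem _ _ (by simpa using h), List.getElem_map]

lemma Is1A.eq_of {n : ℕ} {mu lam : ℕ → ℕ} {A : ℕ → Multiset ℕ} {d d' : Equiv.Perm (Fin n)}
    (hm : Monotone fun p : Fin n => rowOf lam p) (h : Is1A mu lam A d) (h' : Is1A mu lam A d') :
    d = d' := by
  rw [RowIncreasing.eq_sort hm h.1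
    (f := fun z : Fin n => entryAt A (rowOf mu z) ((z : ℕ) - cumSum mu (rowOf mu z))) h.2]
  exact (RowIncreasing.eq_sort hm h'.1 h'.2).symm

lemma exists_le_cumSum {n : ℕ} {mu lamt : ℕ → ℕ} {A : ℕ → Multiset ℕ} (hmu : IsComposition n mu)
    (hshape : RowsOfShape mu A) (hlamt : ∀ v, lamt v = ∑ᶠ s, (A (s+1)).count v) :
    ∃ r, n ≤ cumSum (fun s => if s = 0 then mu 0 else lamt (s-1)) r := by
  obtain ⟨N, hN, hsum⟩ := hmu
  set M : Multiset ℕ := ∑ s ∈ Finset.range N, A (s + 1) with hM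
  have hcount : ∀ v, lamt v = M.count v := fun v => by
    rw [hlamt, hM, Multiset.count_sum']
    refine finsum_eq_sum_of_support_subset _ fun s hs => ?_
    by_contra hcon
    rw [Finset.coe_range, Set.mem_Iio, not_lt] at hcon
    have h0 : A (s + 1) = 0 := by
      rw [← Multiset.card_eq_zero, hshape, hN _ (by omega)]
    simp [h0] at hs
  have hcard : ∑ v ∈ Finset.range (M.sup + 1), M.count v = M.card :=
    Multiset.sum_count_eq_card fun a ha =>
      Finset.mem_range.2 (Nat.lt_succ_of_le (Multiset.le_sup ha))
  have hcardM : M.card = ∑ s ∈ Finset.range N, mu (s + 1) := by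
    rw [hM, Multiset.card_sum]
    exact Finset.sum_congr rfl fun s _ => hshape _
  have hn : cumSum mu (N + 1) = n := by
    rw [cumSum, Finset.sum_range_succ, hN N le_rfl, add_zero, ← hsum, cumSum]
  refine ⟨M.sup + 1 + 1, ?_⟩
  rw [← hn, cumSum, cumSum, Finset.sum_range_succ', Finset.sum_range_succ', ← hcardM, ← hcard]
  simp [hcount]


/-- Lemma: `φ_B φ_C = φ_A`, factorisation through the first row.
`A` a row-standard `μ`-tableau of type `λ`; `λ̃` the type of `A` minus its first row;
`κ = (μ_1, λ̃_1, λ̃_2, …)`; `B` obtained from `A` by making the first row constant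
(all entries `0`) and increasing all other entries by `1` (a `μ`-tableau of type `κ`);
`C` the `κ`-tableau whose first row is the first row of `A` and whose row `i ≥ 2`
consists of `λ̃_{i-1}` copies of `i-1` (0-indexed: row `s ≥ 1` has `λ̃_{s-1}` copies of
`s-1`), a tableau of type `λ`.  Then `φ_B φ_C = φ_A` as maps `M^μ → M^λ`
(apply `φ_B` first). -/
theorem factor_through_first_row
    {F : Type*} [Field F] {H : Type*} [Ring H] [Algebra F H]
    {n : ℕ} (q : F) (hq : q ≠ 0)
    (mu lam lamt : ℕ → ℕ) (hmu : IsPartition n mu) (hlam : IsComposition n lam)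
    (T : Equiv.Perm (Fin n) → H) (hT : IsHeckeBasis q T)
    (A : ℕ → Multiset ℕ) (hshape : RowsOfShape mu A) (htype : HasType A lam)
    (hlamt : ∀ v, lamt v = ∑ᶠ s, (A (s+1)).count v)
    (dA : Equiv.Perm (Fin n)) (hdA : Is1A mu lam A dA)
    (dB : Equiv.Perm (Fin n))
    (hdB : Is1A mu (fun s => if s = 0 then mu 0 else lamt (s-1))
      (fun s => if s = 0 then Multiset.replicate (mu 0) 0 else (A s).map (· + 1)) dB)
    (dC : Equiv.Perm (Fin n))
    (hdC : Is1A (fun s => if s = 0 then mu 0 else lamt (s-1)) lam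
      (fun s => if s = 0 then A 0 else Multiset.replicate (lamt (s-1)) (s-1)) dC)
    (Mmu : Submodule Hᵐᵒᵖ H) (hMmu : Mmu = Submodule.span Hᵐᵒᵖ {xElt T mu})
    (Mkap : Submodule Hᵐᵒᵖ H)
    (hMkap : Mkap = Submodule.span Hᵐᵒᵖ
      {xElt T (fun s => if s = 0 then mu 0 else lamt (s-1))})
    (hxmu : xElt T mu ∈ Mmu)
    (hxkap : xElt T (fun s => if s = 0 then mu 0 else lamt (s-1)) ∈ Mkap)
    (φB : Mmu →ₗ[Hᵐᵒᵖ] H)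
    (hφB : φB ⟨xElt T mu, hxmu⟩
      = XPhi T (fun s => if s = 0 then mu 0 else lamt (s-1)) mu dB)
    (hrange : ∀ z : Mmu, φB z ∈ Mkap)
    (φC : Mkap →ₗ[Hᵐᵒᵖ] H)
    (hφC : φC ⟨xElt T (fun s => if s = 0 then mu 0 else lamt (s-1)), hxkap⟩
      = XPhi T lam (fun s => if s = 0 then mu 0 else lamt (s-1)) dC)
    (φA : Mmu →ₗ[Hᵐᵒᵖ] H)
    (hφA : φA ⟨xElt T mu, hxmu⟩ = XPhi T lam mu dA) :
    ∀ z : Mmu, φC ⟨φB z, hrange z⟩ = φA z := by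
  set kap : ℕ → ℕ := fun s => if s = 0 then mu 0 else lamt (s-1) with hkap
  have hmu_lt : ∀ p : Fin n, ∃ r, (p : ℕ) < cumSum mu r := fun p => by
    obtain ⟨N, -, hN⟩ := hmu.1
    exact ⟨N, hN ▸ p.2⟩
  have hlam_lt : ∀ p : Fin n, ∃ r, (p : ℕ) < cumSum lam r := fun p => by
    obtain ⟨N, -, hN⟩ := hlam
    exact ⟨N, hN ▸ p.2⟩
  have hkap_lt : ∀ p : Fin n, ∃ r, (p : ℕ) < cumSum kap r := fun p => by
    obtain ⟨r, hr⟩ := exists_le_cumSum hmu.1 hshape hlamt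
    exact ⟨r, p.2.trans_le hr⟩
  have hlam_mono : Monotone fun p : Fin n => rowOf lam p := fun p p' h => rowOf_mono h (hlam_lt p')
  have hkap_mono : Monotone fun p : Fin n => rowOf kap p := fun p p' h => rowOf_mono h (hkap_lt p')
  have hmu0 : ∀ p : Fin n, rowOf mu p = 0 ↔ (p : ℕ) < mu 0 := fun p => rowOf_eq_zero (hmu_lt p)
  have hkap0 : ∀ p : Fin n, rowOf kap p = 0 ↔ (p : ℕ) < mu 0 := fun p => rowOf_eq_zero (hkap_lt p)
  have hcolA : ∀ p : Fin n, colIdx mu p < (A (rowOf mu p)).card := fun p => by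
    rw [hshape]
    exact colIdx_lt (hmu_lt p)
  have hentB0 : ∀ p, rowOf mu (dB p : Fin n) = 0 → rowOf kap p = 0 := fun p h => by
    rw [← hdB.2 p, h]
    have hlt : colIdx mu (dB p : Fin n) < mu 0 := h ▸ colIdx_lt (hmu_lt (dB p))
    rw [colIdx, h] at hlt
    refine Multiset.eq_of_mem_replicate (n := mu 0) (entryAt_mem (A := fun s =>
      if s = 0 then Multiset.replicate (mu 0) 0 else (A s).map (· + 1)) (r := 0) ?_)
    simpa using hlt
  have hentB : ∀ p, rowOf mu (dB p : Fin n) ≠ 0 →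
      entryAt A (rowOf mu (dB p : Fin n)) (colIdx mu (dB p : Fin n)) + 1 = rowOf kap p :=
    fun p h => by
      rw [← hdB.2 p]
      exact (entryAt_map_succ (if_neg h) (hcolA (dB p))).symm
  have hb : ∀ p, (dB p : ℕ) < mu 0 ↔ (p : ℕ) < mu 0 := fun p => by
    rw [← hmu0, ← hkap0]
    refine ⟨hentB0 p, fun h => ?_⟩
    by_contra hcon
    have := hentB p hcon
    omega
  have hc : ∀ p, ¬ (dC p : ℕ) < mu 0 → rowOf lam p + 1 = rowOf kap (dC p : Fin n) := fun p hp => by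
    rw [← hkap0] at hp
    have hlt := colIdx_lt (hkap_lt (dC p))
    have hk : kap (rowOf kap (dC p : Fin n)) = lamt (rowOf kap (dC p : Fin n) - 1) := if_neg hp
    have hmem := entryAt_mem (A := fun s =>
      if s = 0 then A 0 else Multiset.replicate (lamt (s-1)) (s-1))
      (r := rowOf kap (dC p : Fin n)) (c := colIdx kap (dC p : Fin n))
      (by simpa [hp, ← hk] using hlt)
    rw [colIdx, hdC.2 p, if_neg hp] at hmem
    have := Multiset.eq_of_mem_replicate hmem
    omega
  have hb0 : ∀ p : Fin n, (p : ℕ) < mu 0 → dB p = p := fun p hp =>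
    eq_self_of_increasing hb (fun z z' hz hz' =>
      hdB.1 z z' (((hkap0 z).2 hz).trans ((hkap0 z').2 hz').symm)) hp
  have hdBC : Is1A mu lam A (dB * dC) := by
    refine ⟨fun p p' hr hp => ?_, fun p => ?_⟩
    · have hlt := hdC.1 p p' hr hp
      rw [Equiv.Perm.mul_apply, Equiv.Perm.mul_apply]
      by_cases h' : (dC p' : ℕ) < mu 0
      · rwa [hb0 _ h', hb0 _ (lt_trans hlt h')]
      · by_cases h : (dC p : ℕ) < mu 0
        · have := mt (hb (dC p')).1 h'
          rw [hb0 _ h, Fin.lt_def]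
          omega
        · exact hdB.1 _ _ (by rw [← hc p h, ← hc p' h', hr]) hlt
    · rw [Equiv.Perm.mul_apply]
      by_cases h : (dC p : ℕ) < mu 0
      · have := hdC.2 p
        rw [(hkap0 _).2 h] at this
        rw [hb0 _ h, (hmu0 _).2 h, ← this]
        simp [entryAt, cumSum]
      · have h1 := hentB (dC p) (mt (fun h' => (hb _).1 ((hmu0 _).1 h')) h)
        rw [← hc p h] at h1
        exact Nat.succ.inj h1
  have hprod : XPhi T lam kap dC * ∑ e ∈ cosetReps kap mu dB, T e = XPhi T lam mu dA := by
    rw [hdA.eq_of hlam_mono hdBC]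
    exact hT.XPhi_mul_sum_cosetReps hlam_mono hkap_mono hkap0 hmu0 hb hdB.1 hc
  rintro ⟨z, hz⟩
  obtain ⟨h, rfl⟩ := Submodule.mem_span_singleton.1 (hMmu ▸ hz)
  have hz' : (⟨h • xElt T mu, hz⟩ : Mmu) = h • ⟨xElt T mu, hxmu⟩ := rfl
  have hval : (⟨φB ⟨h • xElt T mu, hz⟩, hrange _⟩ : Mkap)
      = h • MulOpposite.op (∑ e ∈ cosetReps kap mu dB, T e) • ⟨xElt T kap, hxkap⟩ := by
    apply Subtype.ext
    change φB ⟨h • xElt T mu, hz⟩ =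
      h • MulOpposite.op (∑ e ∈ cosetReps kap mu dB, T e) • xElt T kap
    rw [hz', map_smul, hφB, hT.XPhi_eq hkap_mono]
    rfl
  have hφC' : φC ⟨xElt T kap, hxkap⟩ = XPhi T lam kap dC := hφC
  rw [hval, map_smul, map_smul, hφC', hz', map_smul, hφA, ← hprod]
  rfl

end FayersSemistd
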